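/- Let f, g and h be entire functions given by everywhere absolutely convergent vector valued Dirichlet series, and let p ≥ 0, q ≥ 0, m ≥ 0 be integers. Assume 0 < λ_h^{(m,q)}(f) ≤ ρ_h^{(m,q)}(f) < +∞, 0 < λ_h^{(m,p)}(g) ≤ ρ_h^{(m,p)}(g) < +∞, and that the indicators τ̄_h^{(m,q)}(f), τ_h^{(m,p)}(g), Δ̄_h^{(m,p)}(g) are all positive and finite. Then Δ_g^{(p,q)}(f) ≤ min{ (τ̄_h^{(m,q)}(f)/τ_h^{(m,p)}(g))^{1/λ_h^{(m,p)}(g)}, (τ̄_h^{(m,q)}(f)/Δ̄_h^{(m,p)}(g))^{1/ρ_h^{(m,p)}(g)} }. -/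

import Mathlib

open Filter Topology

noncomputable section

/-- An entire function given by an everywhere absolutely convergent
vector valued Dirichlet series, with coefficients in a Banach space `E`. -/
structure VVDS (E : Type*) [NormedAddCommGroup E] [NormedSpace ℂ E] [CompleteSpace E] where
  a : ℕ → E
  lam : ℕ → ℝ
  lam_pos : ∀ n, 0 < lam n
  lam_strictMono : StrictMono lam
  lam_tendsto : Tendsto lam atTop atTop
  log_index_bound : ∃ D : ℝ, ∀ᶠ n : ℕ in atTop, Real.log (n : ℝ) / lam n ≤ D
  coeff_decay : Tendsto (fun n => Real.log ‖a n‖ / lam n) atTop atBot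
  abs_conv : ∀ s : ℂ, Summable (fun n => Real.exp (s.re * lam n) * ‖a n‖)

variable {E F G : Type*} [NormedAddCommGroup E] [NormedSpace ℂ E] [CompleteSpace E]
  [NormedAddCommGroup F] [NormedSpace ℂ F] [CompleteSpace F]
  [NormedAddCommGroup G] [NormedSpace ℂ G] [CompleteSpace G]

/-- The entire function defined by the vector valued Dirichlet series. -/
def VVDS.toFun (f : VVDS E) (s : ℂ) : E := ∑' n, Complex.exp (s * (f.lam n : ℂ)) • f.a n

/-- The maximum modulus function `M_f(σ) = sup_t ‖f(σ+it)‖`. -/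
def VVDS.M (f : VVDS E) (σ : ℝ) : ℝ := ⨆ t : ℝ, ‖f.toFun ((σ : ℂ) + (t : ℂ) * Complex.I)‖

/-- The inverse function of the maximum modulus function. -/
def VVDS.Minv (f : VVDS E) (y : ℝ) : ℝ := sInf {σ : ℝ | y ≤ f.M σ}

/-- The (p,q)-th relative Ritt order of `f` with respect to `g`. -/
def relRittOrder (p q : ℕ) (f : VVDS E) (g : VVDS F) : EReal :=
  limsup (fun σ : ℝ =>
    ((Real.log^[p] (g.Minv (f.M σ)) / Real.log^[q] σ : ℝ) : EReal)) atTop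

/-- The (p,q)-th relative Ritt lower order of `f` with respect to `g`. -/
def relRittLowerOrder (p q : ℕ) (f : VVDS E) (g : VVDS F) : EReal :=
  liminf (fun σ : ℝ =>
    ((Real.log^[p] (g.Minv (f.M σ)) / Real.log^[q] σ : ℝ) : EReal)) atTop

/-- The (p,q)-th relative Ritt type of `f` with respect to `g`. -/
def relRittType (p q : ℕ) (f : VVDS E) (g : VVDS F) : EReal :=
  limsup (fun σ : ℝ =>
    ((Real.log^[p-1] (g.Minv (f.M σ)) /
      (Real.log^[q-1] σ) ^ (relRittOrder p q f g).toReal : ℝ) : EReal)) atTop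

/-- The (p,q)-th relative Ritt lower type of `f` with respect to `g`. -/
def relRittLowerType (p q : ℕ) (f : VVDS E) (g : VVDS F) : EReal :=
  liminf (fun σ : ℝ =>
    ((Real.log^[p-1] (g.Minv (f.M σ)) /
      (Real.log^[q-1] σ) ^ (relRittOrder p q f g).toReal : ℝ) : EReal)) atTop

/-- The (p,q)-th relative Ritt weak type of `f` with respect to `g`. -/
def relRittWeakType (p q : ℕ) (f : VVDS E) (g : VVDS F) : EReal :=
  liminf (fun σ : ℝ =>
    ((Real.log^[p-1] (g.Minv (f.M σ)) /
      (Real.log^[q-1] σ) ^ (relRittLowerOrder p q f g).toReal : ℝ) : EReal)) atTop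

/-- The growth indicator `τ̄_g^{(p,q)}(f)`. -/
def relRittUpperWeakType (p q : ℕ) (f : VVDS E) (g : VVDS F) : EReal :=
  limsup (fun σ : ℝ =>
    ((Real.log^[p-1] (g.Minv (f.M σ)) /
      (Real.log^[q-1] σ) ^ (relRittLowerOrder p q f g).toReal : ℝ) : EReal)) atTop

theorem VVDS.summ (f : VVDS E) (σ : ℝ) :
    Summable (fun n => Real.exp (σ * f.lam n) * ‖f.a n‖) := by
  simpa using f.abs_conv (σ : ℂ)

def VVDS.B (f : VVDS E) (σ : ℝ) : ℝ := ∑' n, Real.exp (σ * f.lam n) * ‖f.a n‖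

theorem VVDS.norm_term (f : VVDS E) (σ t : ℝ) (n : ℕ) :
    ‖Complex.exp (((σ : ℂ) + (t : ℂ) * Complex.I) * (f.lam n : ℂ)) • f.a n‖
      = Real.exp (σ * f.lam n) * ‖f.a n‖ := by
  rw [norm_smul, Complex.norm_exp]
  simp

theorem VVDS.summ_term (f : VVDS E) (σ t : ℝ) :
    Summable (fun n => Complex.exp (((σ : ℂ) + (t : ℂ) * Complex.I) * (f.lam n : ℂ)) • f.a n) := by
  apply Summable.of_norm
  simp only [f.norm_term]
  exact f.summ σ

theorem VVDS.norm_le_B (f : VVDS E) (σ t : ℝ) :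
    ‖f.toFun ((σ : ℂ) + (t : ℂ) * Complex.I)‖ ≤ f.B σ := by
  unfold VVDS.toFun VVDS.B
  refine (norm_tsum_le_tsum_norm ?_).trans (le_of_eq ?_)
  · simp only [f.norm_term]
    exact f.summ σ
  · simp only [f.norm_term]

theorem VVDS.bdd (f : VVDS E) (σ : ℝ) :
    BddAbove (Set.range fun t : ℝ => ‖f.toFun ((σ : ℂ) + (t : ℂ) * Complex.I)‖) :=
  ⟨f.B σ, by rintro _ ⟨t, rfl⟩; exact f.norm_le_B σ t⟩

theorem VVDS.le_M (f : VVDS E) (σ t : ℝ) :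
    ‖f.toFun ((σ : ℂ) + (t : ℂ) * Complex.I)‖ ≤ f.M σ := le_ciSup (f.bdd σ) t

theorem VVDS.M_le_B (f : VVDS E) (σ : ℝ) : f.M σ ≤ f.B σ := ciSup_le (f.norm_le_B σ)

theorem VVDS.B_mono (f : VVDS E) : Monotone f.B := by
  intro x y hxy
  refine (f.summ x).tsum_le_tsum (fun n => ?_) (f.summ y)
  have := f.lam_pos n
  gcongr

theorem VVDS.M_sub (f : VVDS E) (x y : ℝ) :
    f.M x ≤ f.M y + ∑' n, |Real.exp (x * f.lam n) - Real.exp (y * f.lam n)| * ‖f.a n‖ := by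
  apply ciSup_le
  intro t
  have hs : Summable fun n => |Real.exp (x * f.lam n) - Real.exp (y * f.lam n)| * ‖f.a n‖ := by
    refine Summable.of_nonneg_of_le (fun n => by positivity) (fun n => ?_)
      ((f.summ x).add (f.summ y))
    rw [← add_mul]
    gcongr
    refine (abs_sub _ _).trans ?_
    simp
  have h1 : ∀ n, ‖Complex.exp (((x : ℂ) + (t : ℂ) * Complex.I) * (f.lam n : ℂ)) • f.a n -
      Complex.exp (((y : ℂ) + (t : ℂ) * Complex.I) * (f.lam n : ℂ)) • f.a n‖ =
      |Real.exp (x * f.lam n) - Real.exp (y * f.lam n)| * ‖f.a n‖ := by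
    intro n
    rw [← sub_smul, norm_smul]
    congr 1
    rw [add_mul, add_mul, Complex.exp_add, Complex.exp_add, ← sub_mul, norm_mul]
    have : ‖Complex.exp ((t : ℂ) * Complex.I * (f.lam n : ℂ))‖ = 1 := by
      rw [Complex.norm_exp]; simp
    rw [this, mul_one, ← Complex.ofReal_mul, ← Complex.ofReal_mul, ← Complex.ofReal_exp,
      ← Complex.ofReal_exp, ← Complex.ofReal_sub, Complex.norm_real, Real.norm_eq_abs]
  have h2 : ‖f.toFun ((x : ℂ) + (t : ℂ) * Complex.I) - f.toFun ((y : ℂ) + (t : ℂ) * Complex.I)‖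
      ≤ ∑' n, |Real.exp (x * f.lam n) - Real.exp (y * f.lam n)| * ‖f.a n‖ := by
    unfold VVDS.toFun
    rw [← (f.summ_term x t).tsum_sub (f.summ_term y t)]
    refine (norm_tsum_le_tsum_norm ?_).trans (le_of_eq ?_)
    · simp only [h1]; exact hs
    · simp only [h1]
  have h3 := f.le_M y t
  have h4 := norm_le_norm_add_norm_sub' (f.toFun ((x : ℂ) + (t : ℂ) * Complex.I))
    (f.toFun ((y : ℂ) + (t : ℂ) * Complex.I))
  linarith

theorem VVDS.M_cont (f : VVDS E) : Continuous f.M := by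
  rw [continuous_iff_continuousAt]
  intro y
  have key : Tendsto (fun x => ∑' n, |Real.exp (x * f.lam n) - Real.exp (y * f.lam n)| * ‖f.a n‖)
      (𝓝 y) (𝓝 (∑' n : ℕ, (0 : ℝ))) := by
    refine tendsto_tsum_of_dominated_convergence ((f.summ (y+1)).add (f.summ y)) ?_ ?_
    · intro n
      have : Continuous fun x : ℝ => |Real.exp (x * f.lam n) - Real.exp (y * f.lam n)| * ‖f.a n‖ := by
        fun_prop
      simpa using this.tendsto y
    · filter_upwards [eventually_lt_nhds (show y < y + 1 by linarith)] with x hx n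
      rw [← add_mul, norm_mul, norm_norm, Real.norm_eq_abs, abs_abs]
      gcongr
      refine (abs_sub _ _).trans ?_
      simp only [Real.abs_exp]
      have := f.lam_pos n
      gcongr
  rw [tsum_zero] at key
  rw [ContinuousAt, tendsto_iff_norm_sub_tendsto_zero]
  refine squeeze_zero (fun _ => norm_nonneg _) (fun x => ?_) key
  have h1 := f.M_sub x y
  have h2 := f.M_sub y x
  simp_rw [abs_sub_comm (Real.exp (y * _)) (Real.exp (x * _))] at h2
  rw [Real.norm_eq_abs, abs_le]
  constructor <;> linarith

theorem VVDS.coeff_le (f : VVDS E) (σ : ℝ) (n : ℕ) :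
    Real.exp (σ * f.lam n) * ‖f.a n‖ ≤ f.M σ := by
  set c : ℕ → E := fun k => (Real.exp (σ * f.lam k) : ℂ) • f.a k with hc
  have hcn : ∀ k, ‖c k‖ = Real.exp (σ * f.lam k) * ‖f.a k‖ := by
    intro k
    simp only [hc, norm_smul, Complex.norm_real, Real.norm_eq_abs, Real.abs_exp]
  have hcs : Summable fun k => ‖c k‖ := by simp only [hcn]; exact f.summ σ
  set μ : ℕ → ℝ := fun k => f.lam k - f.lam n with hμ
  set e : ℕ → ℝ → ℂ := fun k t => Complex.exp ((μ k : ℂ) * Complex.I * t) with he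
  have hen : ∀ k t, ‖e k t‖ = 1 := by
    intro k t
    simp only [he, Complex.norm_exp]; simp
  set H : ℝ → E := fun t => Complex.exp (-(f.lam n : ℂ) * Complex.I * t) •
    f.toFun ((σ : ℂ) + (t : ℂ) * Complex.I) with hH
  have hHn : ∀ t, ‖H t‖ ≤ f.M σ := by
    intro t
    simp only [hH, norm_smul, Complex.norm_exp]
    simpa using f.le_M σ t
  have hsum : ∀ t, HasSum (fun k => e k t • c k) (H t) := by
    intro t
    have := (f.summ_term σ t).hasSum.const_smul (Complex.exp (-(f.lam n : ℂ) * Complex.I * t))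
    convert this using 2 with k
    · simp only [he, hc, smul_smul, Complex.ofReal_exp, ← Complex.exp_add, hμ]
      congr 2
      push_cast
      ring
    · rfl
  have hI : ∀ T : ℝ, HasSum (fun k => ∫ t in (0:ℝ)..T, e k t • c k) (∫ t in (0:ℝ)..T, H t) := by
    intro T
    refine intervalIntegral.hasSum_integral_of_dominated_convergence (fun k _ => ‖c k‖) ?_ ?_ ?_ ?_ ?_
    · intro k
      apply Continuous.aestronglyMeasurable
      fun_prop
    · intro k
      refine Eventually.of_forall fun t _ => ?_
      rw [norm_smul, hen, one_mul]
    · exact Eventually.of_forall fun t _ => hcs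
    · simp
    · exact Eventually.of_forall fun t _ => hsum t
  have hlim : Tendsto (fun T : ℝ => ∑' k, (T⁻¹ : ℝ) • ∫ t in (0:ℝ)..T, e k t • c k) atTop
      (𝓝 (∑' k, if k = n then c n else 0)) := by
    refine tendsto_tsum_of_dominated_convergence hcs ?_ ?_
    · intro k
      by_cases hk : k = n
      · subst hk
        simp only [if_true]
        refine tendsto_const_nhds.congr' ?_
        filter_upwards [eventually_gt_atTop 0] with T hT
        have : ∀ t, e k t = 1 := by intro t; simp [he, hμ]
        simp only [this, one_smul, intervalIntegral.integral_const, sub_zero, smul_smul]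
        rw [inv_mul_cancel₀ hT.ne', one_smul]
      · simp only [hk, if_false]
        have hμk : μ k ≠ 0 := by
          simp only [hμ, sub_ne_zero]
          exact fun h => hk (f.lam_strictMono.injective h)
        rw [tendsto_zero_iff_norm_tendsto_zero]
        have : Tendsto (fun T : ℝ => T⁻¹ * (2 / |μ k| * ‖c k‖)) atTop (𝓝 0) := by
          simpa using tendsto_inv_atTop_zero.mul_const (2 / |μ k| * ‖c k‖)
        refine squeeze_zero' (Eventually.of_forall fun _ => norm_nonneg _) ?_ this
        filter_upwards [eventually_gt_atTop 0] with T hT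
        rw [norm_smul, Real.norm_eq_abs, abs_of_pos (inv_pos.2 hT),
          intervalIntegral.integral_smul_const, norm_smul]
        gcongr
        have hne : (μ k : ℂ) * Complex.I ≠ 0 := by simp [hμk]
        simp only [he]
        rw [integral_exp_mul_complex hne, norm_div]
        have h3 : ‖(μ k : ℂ) * Complex.I‖ = |μ k| := by simp
        rw [h3]
        gcongr
        refine (norm_sub_le _ _).trans ?_
        have h4 := hen k T
        have h5 := hen k 0
        simp only [he] at h4 h5
        rw [h4, h5]; norm_num
    · filter_upwards [eventually_gt_atTop 0] with T hT k
      rw [norm_smul, Real.norm_eq_abs, abs_of_pos (inv_pos.2 hT)]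
      have := intervalIntegral.norm_integral_le_of_norm_le_const (a := 0) (b := T) (C := ‖c k‖)
        (f := fun t => e k t • c k) (fun t _ => by rw [norm_smul, hen, one_mul])
      rw [sub_zero, abs_of_pos hT] at this
      calc T⁻¹ * _ ≤ T⁻¹ * (‖c k‖ * T) := by gcongr
        _ = ‖c k‖ := by field_simp
  rw [tsum_ite_eq] at hlim
  rw [← hcn]
  refine le_of_tendsto hlim.norm ?_
  filter_upwards [eventually_gt_atTop 0] with T hT
  rw [((hI T).const_smul (T⁻¹ : ℝ)).tsum_eq, norm_smul, Real.norm_eq_abs, abs_of_pos (inv_pos.2 hT)]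
  have := intervalIntegral.norm_integral_le_of_norm_le_const (a := 0) (b := T) (C := f.M σ)
        (f := H) (fun t _ => hHn t)
  rw [sub_zero, abs_of_pos hT] at this
  calc T⁻¹ * _ ≤ T⁻¹ * (f.M σ * T) := by gcongr
    _ = f.M σ := by field_simp

theorem VVDS.M_tendsto (f : VVDS E) : Tendsto f.M atTop atTop := by
  obtain ⟨n, hn⟩ := (f.coeff_decay.eventually (eventually_lt_atBot 0)).exists
  have ha : f.a n ≠ 0 := by
    intro h0
    simp [h0] at hn
  refine tendsto_atTop_mono (fun σ => f.coeff_le σ n) ?_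
  refine Tendsto.atTop_mul_const (norm_pos_iff.2 ha) ?_
  exact Real.tendsto_exp_atTop.comp (tendsto_id.atTop_mul_const (f.lam_pos n))

theorem VVDS.Minv_lb (f : VVDS E) (K y : ℝ) (hy : f.B K < y) :
    K ∈ lowerBounds {σ : ℝ | y ≤ f.M σ} := by
  intro σ hσ
  by_contra hlt
  push Not at hlt
  have := f.B_mono hlt.le
  have h2 := f.M_le_B σ
  simp only [Set.mem_ofPred_eq] at hσ
  linarith

theorem VVDS.Minv_ne (f : VVDS E) (y : ℝ) : {σ : ℝ | y ≤ f.M σ}.Nonempty :=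
  (f.M_tendsto.eventually (eventually_ge_atTop y)).exists

theorem VVDS.Minv_tendsto (f : VVDS E) : Tendsto f.Minv atTop atTop := by
  rw [tendsto_atTop]
  intro K
  filter_upwards [eventually_gt_atTop (f.B K)] with y hy
  exact le_csInf (f.Minv_ne y) (f.Minv_lb K y hy)

theorem VVDS.M_Minv (f : VVDS E) : ∀ᶠ y in atTop, f.M (f.Minv y) = y := by
  filter_upwards [eventually_gt_atTop (f.B 0)] with y hy
  have hb : BddBelow {σ : ℝ | y ≤ f.M σ} := ⟨0, f.Minv_lb 0 y hy⟩
  have hc : IsClosed {σ : ℝ | y ≤ f.M σ} := isClosed_le continuous_const f.M_cont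
  apply le_antisymm
  · by_contra hlt
    push Not at hlt
    have hev : ∀ᶠ x in 𝓝 (f.Minv y), y < f.M x :=
      f.M_cont.continuousAt.eventually (eventually_gt_nhds hlt)
    have h2 : ∀ᶠ x in 𝓝[<] (f.Minv y), y < f.M x := nhdsWithin_le_nhds hev
    obtain ⟨x, hx, hx2⟩ := (h2.and self_mem_nhdsWithin).exists
    have h3 : f.Minv y ≤ x := csInf_le hb hx.le
    exact absurd hx2 (not_lt.2 h3)
  · exact hc.csInf_mem (f.Minv_ne y) hb

theorem ev_of_lt_liminf {u : ℝ → ℝ} {a : ℝ}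
    (h : (a : EReal) < liminf (fun σ => (u σ : EReal)) atTop) : ∀ᶠ σ in atTop, a < u σ := by
  filter_upwards [eventually_lt_of_lt_liminf h] with σ hσ
  exact_mod_cast hσ

theorem ev_of_limsup_lt {u : ℝ → ℝ} {a : ℝ}
    (h : limsup (fun σ => (u σ : EReal)) atTop < (a : EReal)) : ∀ᶠ σ in atTop, u σ < a := by
  filter_upwards [eventually_lt_of_limsup_lt h] with σ hσ
  exact_mod_cast hσ

theorem le_liminf_of_ev {u : ℝ → ℝ} {a : ℝ} (h : ∀ᶠ σ in atTop, a ≤ u σ) :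
    (a : EReal) ≤ liminf (fun σ => (u σ : EReal)) atTop := by
  apply le_liminf_of_le
  · isBoundedDefault
  · filter_upwards [h] with σ hσ
    exact_mod_cast hσ

theorem limsup_le_of_ev {u : ℝ → ℝ} {a : ℝ} (h : ∀ᶠ σ in atTop, u σ ≤ a) :
    limsup (fun σ => (u σ : EReal)) atTop ≤ (a : EReal) := by
  apply limsup_le_of_le
  · isBoundedDefault
  · filter_upwards [h] with σ hσ
    exact_mod_cast hσ

theorem liminf_le_limsup' (u : ℝ → ℝ) :
    liminf (fun σ => (u σ : EReal)) atTop ≤ limsup (fun σ => (u σ : EReal)) atTop :=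
  liminf_le_limsup

/-- a positive finite extended real is a positive real -/
theorem ereal_pos_real {x : EReal} (h0 : 0 < x) (h1 : x < ⊤) : ∃ r : ℝ, 0 < r ∧ x = r := by
  induction x with
  | bot => simp at h0
  | top => simp at h1
  | coe r => exact ⟨r, by exact_mod_cast h0, rfl⟩

theorem ereal_lt_real {x : EReal} (h1 : x < ⊤) : ∃ r : ℝ, 0 < r ∧ x < r := by
  obtain ⟨r, hr⟩ := EReal.lt_iff_exists_real_btwn.1 h1
  refine ⟨max r 1, by positivity, lt_of_lt_of_le hr.1 ?_⟩
  exact_mod_cast le_max_left _ _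

theorem tendsto_log_iter (k : ℕ) {u : ℝ → ℝ} (hu : Tendsto u atTop atTop) :
    Tendsto (fun σ => Real.log^[k] (u σ)) atTop atTop := by
  induction k with
  | zero => simpa using hu
  | succ k ih =>
    simp only [Function.iterate_succ_apply']
    exact Real.tendsto_log_atTop.comp ih

/-- Contradictory case `C = O(log B)`. -/
theorem case_L1 {B C : ℝ → ℝ} {r : ℝ} (hr : 0 < r) (hB : Tendsto B atTop atTop)
    (h1 : limsup (fun σ => ((C σ / Real.log (B σ) : ℝ) : EReal)) atTop < ⊤)
    (h2 : (0 : EReal) < liminf (fun σ => ((C σ / (B σ) ^ r : ℝ) : EReal)) atTop) : False := by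
  obtain ⟨K, hK, hlt⟩ := ereal_lt_real h1
  obtain ⟨e, he0, he⟩ := EReal.lt_iff_exists_real_btwn.1 h2
  have he0' : 0 < e := by exact_mod_cast he0
  have hlim : Tendsto (fun σ => K * (Real.log (B σ) / (B σ) ^ r)) atTop (𝓝 (K * 0)) :=
    (((isLittleO_log_rpow_atTop hr).tendsto_div_nhds_zero).comp hB).const_mul K
  rw [mul_zero] at hlim
  obtain ⟨σ, a1, a2, a3, a4⟩ := ((ev_of_limsup_lt hlt).and ((ev_of_lt_liminf he).and
    ((hB.eventually (eventually_gt_atTop 1)).and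
    (hlim.eventually (eventually_lt_nhds he0'))))).exists
  have hl := Real.log_pos a3
  have hp : 0 < (B σ) ^ r := Real.rpow_pos_of_pos (by linarith) _
  rw [div_lt_iff₀ hl] at a1
  rw [lt_div_iff₀ hp] at a2
  rw [← mul_div_assoc, div_lt_iff₀ hp] at a4
  linarith

/-- Contradictory case `log C ≥ c B`. -/
theorem case_L2 {B C : ℝ → ℝ} {r : ℝ} (hB : Tendsto B atTop atTop)
    (hC : Tendsto C atTop atTop)
    (h1 : (0 : EReal) < liminf (fun σ => ((Real.log (C σ) / B σ : ℝ) : EReal)) atTop)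
    (h2 : liminf (fun σ => ((C σ / (B σ) ^ r : ℝ) : EReal)) atTop < ⊤) : False := by
  obtain ⟨K, hK, hlt⟩ := ereal_lt_real h2
  obtain ⟨e, he0, he⟩ := EReal.lt_iff_exists_real_btwn.1 h1
  have he0' : 0 < e := by exact_mod_cast he0
  have hlim := (tendsto_exp_mul_div_rpow_atTop r e he0').comp hB
  refine absurd (le_liminf_of_ev (u := fun σ => C σ / (B σ) ^ r) (a := K) ?_) (not_le.2 hlt)
  filter_upwards [ev_of_lt_liminf he, hB.eventually (eventually_gt_atTop 1),
    hC.eventually (eventually_gt_atTop 0), hlim.eventually (eventually_ge_atTop K)] with σ a1 a2 a3 a4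
  have hp : 0 < (B σ) ^ r := Real.rpow_pos_of_pos (by linarith) _
  rw [lt_div_iff₀ (by linarith)] at a1
  refine a4.trans ?_
  simp only [Function.comp]
  gcongr
  rw [← Real.le_log_iff_exp_le a3]
  exact a1.le

/-- Case `m = p = 0`: exponent equals one. -/
theorem case_L3 {B C : ℝ → ℝ} {r : ℝ} (hB : Tendsto B atTop atTop)
    (h1 : (0 : EReal) < liminf (fun σ => ((C σ / B σ : ℝ) : EReal)) atTop)
    (h1' : limsup (fun σ => ((C σ / B σ : ℝ) : EReal)) atTop < ⊤)
    (h2 : (0 : EReal) < liminf (fun σ => ((C σ / (B σ) ^ r : ℝ) : EReal)) atTop)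
    (h2' : liminf (fun σ => ((C σ / (B σ) ^ r : ℝ) : EReal)) atTop < ⊤) : r = 1 := by
  obtain ⟨K, hK, hlt⟩ := ereal_lt_real h2'
  obtain ⟨K', hK', hlt'⟩ := ereal_lt_real h1'
  obtain ⟨e, he0, he⟩ := EReal.lt_iff_exists_real_btwn.1 h1
  obtain ⟨e', he0', he'⟩ := EReal.lt_iff_exists_real_btwn.1 h2
  have he0 : 0 < e := by exact_mod_cast he0
  have he0' : 0 < e' := by exact_mod_cast he0'
  rcases lt_trichotomy r 1 with hr | hr | hr
  · exfalso
    have hlim := ((tendsto_rpow_atTop (show 0 < 1 - r by linarith)).comp hB).const_mul_atTop he0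
    refine absurd (le_liminf_of_ev (u := fun σ => C σ / (B σ) ^ r) (a := K) ?_) (not_le.2 hlt)
    filter_upwards [ev_of_lt_liminf he, hB.eventually (eventually_gt_atTop 1),
      hlim.eventually (eventually_ge_atTop K)] with σ a1 a2 a4
    have hp : 0 < (B σ) ^ r := Real.rpow_pos_of_pos (by linarith) _
    rw [lt_div_iff₀ (by linarith)] at a1
    simp only [Function.comp] at a4
    rw [Real.rpow_sub (by linarith), Real.rpow_one, ← mul_div_assoc] at a4
    refine a4.trans ?_
    gcongr
  · exact hr
  · exfalso
    have hlim := ((tendsto_rpow_neg_atTop (show 0 < r - 1 by linarith)).comp hB).const_mul K'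
    rw [mul_zero] at hlim
    obtain ⟨σ, a1, a2, a3, a4⟩ := ((ev_of_limsup_lt hlt').and ((ev_of_lt_liminf he').and
      ((hB.eventually (eventually_gt_atTop 1)).and
      (hlim.eventually (eventually_lt_nhds he0'))))).exists
    have hp : 0 < (B σ) ^ r := Real.rpow_pos_of_pos (by linarith) _
    rw [div_lt_iff₀ (by linarith)] at a1
    simp only [Function.comp] at a4
    rw [neg_sub, Real.rpow_sub (by linarith), Real.rpow_one, ← mul_div_assoc, div_lt_iff₀ hp] at a4
    rw [lt_div_iff₀ hp] at a2
    linarith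

/-- Regular growth case. -/
theorem case_L0 {B C : ℝ → ℝ} {r : ℝ} (hB : Tendsto B atTop atTop)
    (h2 : (0 : EReal) < liminf (fun σ => ((C σ / (B σ) ^ r : ℝ) : EReal)) atTop) :
    (r : EReal) ≤ liminf (fun σ => ((Real.log (C σ) / Real.log (B σ) : ℝ) : EReal)) atTop := by
  obtain ⟨e, he0, he⟩ := EReal.lt_iff_exists_real_btwn.1 h2
  have he0 : 0 < e := by exact_mod_cast he0
  have hl : Tendsto (fun σ => Real.log e / Real.log (B σ)) atTop (𝓝 0) :=
    tendsto_const_nhds.div_atTop (Real.tendsto_log_atTop.comp hB)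
  refine EReal.ge_of_forall_gt_iff_ge.1 fun z hz => ?_
  have hz : z < r := by exact_mod_cast hz
  apply le_liminf_of_ev
  filter_upwards [ev_of_lt_liminf he, hB.eventually (eventually_gt_atTop 1),
    hl.eventually (eventually_gt_nhds (show z - r < 0 by linarith))] with σ a1 a2 a3
  have hp : 0 < (B σ) ^ r := Real.rpow_pos_of_pos (by linarith) _
  have hlB := Real.log_pos a2
  rw [lt_div_iff₀ hp] at a1
  have h3 := Real.log_lt_log (by positivity) a1
  rw [Real.log_mul he0.ne' hp.ne', Real.log_rpow (by linarith)] at h3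
  rw [lt_div_iff₀ hlB] at a3
  rw [le_div_iff₀ hlB]
  nlinarith

/-- the exponent comparison -/
theorem order_ge {U V W : ℝ → ℝ} {l r : ℝ} (hl : 0 < l) (hr : 0 < r)
    (hV : Tendsto V atTop atTop) (hW : Tendsto W atTop atTop)
    (h1 : (l : EReal) ≤ liminf (fun σ => ((U σ / V σ : ℝ) : EReal)) atTop)
    (h2 : ∀ b > r, ∀ᶠ σ in atTop, U σ / W σ < b)
    {K c : ℝ} (hc : 0 < c) 
    (h3 : ∀ᶠ σ in atTop, U σ / V σ < K) (h4 : ∀ᶠ σ in atTop, c < U σ / W σ) :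
    l / r ≤ (limsup (fun σ => ((W σ / V σ : ℝ) : EReal)) atTop).toReal := by
  have hle : limsup (fun σ => ((W σ / V σ : ℝ) : EReal)) atTop ≤ ((K / c : ℝ) : EReal) := by
    apply limsup_le_of_ev
    filter_upwards [h3, h4, hV.eventually (eventually_gt_atTop 0),
      hW.eventually (eventually_gt_atTop 0)] with σ a3 a4 a5 a6
    rw [div_lt_iff₀ a5] at a3
    rw [lt_div_iff₀ a6] at a4
    rw [div_le_div_iff₀ a5 hc]
    linarith
  have hge : ∀ a b, 0 < a → a < l → r < b →
      ((a / b : ℝ) : EReal) ≤ limsup (fun σ => ((W σ / V σ : ℝ) : EReal)) atTop := by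
    intro a b ha0 ha hb
    refine (le_liminf_of_ev ?_).trans (liminf_le_limsup' _)
    have ha' : (a : EReal) < liminf (fun σ => ((U σ / V σ : ℝ) : EReal)) atTop :=
      lt_of_lt_of_le (by exact_mod_cast ha) h1
    filter_upwards [ev_of_lt_liminf ha', h2 b hb, hV.eventually (eventually_gt_atTop 0),
      hW.eventually (eventually_gt_atTop 0)] with σ a3 a4 a5 a6
    rw [lt_div_iff₀ a5] at a3
    rw [div_lt_iff₀ a6] at a4
    rw [div_le_div_iff₀ (by linarith) a5]
    linarith
  generalize limsup (fun σ => ((W σ / V σ : ℝ) : EReal)) atTop = L at hle hge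
  have hL0 := hge (l / 2) (r + 1) (by linarith) (by linarith) (by linarith)
  have hT : L ≠ ⊤ := fun h => by simp [h] at hle
  have hBt : L ≠ ⊥ := fun h => by simp [h] at hL0
  lift L to ℝ using ⟨hT, hBt⟩
  simp only [EReal.coe_le_coe_iff] at hge
  rw [EReal.toReal_coe]
  have hcont : Tendsto (fun t : ℝ => (l - t) / (r + t)) (𝓝[>] 0) (𝓝 ((l - 0) / (r + 0))) := by
    have : ContinuousAt (fun t : ℝ => (l - t) / (r + t)) 0 := by
      apply ContinuousAt.div (by fun_prop) (by fun_prop) (by simp; exact hr.ne')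
    exact this.tendsto.mono_left nhdsWithin_le_nhds
  simp only [sub_zero, add_zero] at hcont
  refine le_of_tendsto hcont ?_
  have h5 : ∀ᶠ t : ℝ in 𝓝[>] 0, t < l := nhdsWithin_le_nhds (eventually_lt_nhds hl)
  filter_upwards [h5, self_mem_nhdsWithin] with t ht ht0
  have ht0 : 0 < t := ht0
  exact hge _ _ (by linarith) (by linarith) (by linarith)

/-- the type comparison -/
theorem type_le {A B C : ℝ → ℝ} {l r ρ T D : ℝ} (hr : 0 < r) (hD : 0 < D) (hT : 0 < T)
    (hA : Tendsto A atTop atTop) (hB : Tendsto B atTop atTop)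
    (h1 : ∀ c > T, ∀ᶠ σ in atTop, C σ / (A σ) ^ l < c)
    (h2 : ∀ c < D, ∀ᶠ σ in atTop, c < C σ / (B σ) ^ r)
    (hρ : l / r ≤ ρ) :
    limsup (fun σ => ((B σ / (A σ) ^ ρ : ℝ) : EReal)) atTop ≤ (((T / D) ^ (1 / r) : ℝ) : EReal) := by
  have hle : ∀ c d, T < c → 0 < d → d < D →
      limsup (fun σ => ((B σ / (A σ) ^ ρ : ℝ) : EReal)) atTop ≤ (((c / d) ^ (1 / r) : ℝ) : EReal) := by
    intro c d hc hd0 hd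
    apply limsup_le_of_ev
    filter_upwards [h1 c hc, h2 d hd, hA.eventually (eventually_gt_atTop 1),
      hB.eventually (eventually_gt_atTop 1)] with σ a1 a2 a3 a4
    have hA0 : 0 < A σ := by linarith
    have hB0 : 0 < B σ := by linarith
    have hc0 : 0 < c := by linarith
    have hAp : 0 < (A σ) ^ l := Real.rpow_pos_of_pos hA0 _
    have hBp : 0 < (B σ) ^ r := Real.rpow_pos_of_pos hB0 _
    rw [div_lt_iff₀ hAp] at a1
    rw [lt_div_iff₀ hBp] at a2
    have h3 : (B σ) ^ r ≤ (c / d) * (A σ) ^ l := by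
      rw [div_mul_eq_mul_div, le_div_iff₀ hd0]
      linarith
    have h4 := Real.rpow_le_rpow hBp.le h3 (show 0 ≤ 1 / r by positivity)
    rw [← Real.rpow_mul hB0.le, mul_one_div_cancel hr.ne', Real.rpow_one,
      Real.mul_rpow (by positivity) hAp.le, ← Real.rpow_mul hA0.le, mul_one_div] at h4
    rw [div_le_iff₀ (Real.rpow_pos_of_pos hA0 _)]
    refine h4.trans ?_
    gcongr
    exact a3.le
  have hcont : Tendsto (fun t : ℝ => (((T + t) / (D - t)) ^ (1 / r) : ℝ)) (𝓝[>] 0)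
      (𝓝 (((T + 0) / (D - 0)) ^ (1 / r))) := by
    have : ContinuousAt (fun t : ℝ => (((T + t) / (D - t)) ^ (1 / r) : ℝ)) 0 := by
      apply ContinuousAt.rpow_const
      · apply ContinuousAt.div (by fun_prop) (by fun_prop) (by simp; exact hD.ne')
      · right; positivity
    exact this.tendsto.mono_left nhdsWithin_le_nhds
  simp only [sub_zero, add_zero] at hcont
  refine ge_of_tendsto ((continuous_coe_real_ereal.tendsto _).comp hcont) ?_
  have h5 : ∀ᶠ t : ℝ in 𝓝[>] 0, t < D := nhdsWithin_le_nhds (eventually_lt_nhds hD)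
  filter_upwards [h5, self_mem_nhdsWithin] with t ht ht0
  have ht0 : 0 < t := ht0
  exact hle _ _ (by linarith) (by linarith) (by linarith)

theorem stmt_11 (f : VVDS E) (g : VVDS F) (h : VVDS G) (p q m : ℕ)
    (hf1 : (0 : EReal) < relRittLowerOrder m q f h)
    (hf2 : relRittLowerOrder m q f h ≤ relRittOrder m q f h)
    (hf3 : relRittOrder m q f h < ⊤)
    (hg1 : (0 : EReal) < relRittLowerOrder m p g h)
    (hg2 : relRittLowerOrder m p g h ≤ relRittOrder m p g h)
    (hg3 : relRittOrder m p g h < ⊤)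
    (htbf1 : (0 : EReal) < relRittUpperWeakType m q f h)
    (htbf2 : relRittUpperWeakType m q f h < ⊤)
    (htg1 : (0 : EReal) < relRittWeakType m p g h)
    (htg2 : relRittWeakType m p g h < ⊤)
    (hDbg1 : (0 : EReal) < relRittLowerType m p g h)
    (hDbg2 : relRittLowerType m p g h < ⊤)
    :
    relRittType p q f g ≤ ((min (((relRittUpperWeakType m q f h).toReal / (relRittWeakType m p g h).toReal) ^ (1 / (relRittLowerOrder m p g h).toReal)) (((relRittUpperWeakType m q f h).toReal / (relRittLowerType m p g h).toReal) ^ (1 / (relRittOrder m p g h).toReal)) : ℝ) : EReal) := by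
  obtain ⟨lf, hlf, elf⟩ := ereal_pos_real hf1 (hf2.trans_lt hf3)
  obtain ⟨lg, hlg, elg⟩ := ereal_pos_real hg1 (hg2.trans_lt hg3)
  obtain ⟨rg, hrg, erg⟩ := ereal_pos_real (hg1.trans_le hg2) hg3
  obtain ⟨T, hT, eT⟩ := ereal_pos_real htbf1 htbf2
  obtain ⟨D, hD, eD⟩ := ereal_pos_real hDbg1 hDbg2
  set φ : ℝ → ℝ := fun σ => h.Minv (f.M σ) with hφ
  set ψ : ℝ → ℝ := fun σ => h.Minv (g.M σ) with hψ
  set X : ℝ → ℝ := fun σ => g.Minv (f.M σ) with hX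
  have hψt : Tendsto ψ atTop atTop := h.Minv_tendsto.comp g.M_tendsto
  have hXt : Tendsto X atTop atTop := g.Minv_tendsto.comp f.M_tendsto
  have hcomp : ∀ᶠ σ in atTop, ψ (X σ) = φ σ := by
    filter_upwards [f.M_tendsto.eventually g.M_Minv] with σ hσ
    simp only [hψ, hX, hφ, hσ]
  -- regular growth of `g`
  have hreg : relRittLowerOrder m p g h = relRittOrder m p g h := by
    have k1 := hDbg1
    have k2 := hDbg2
    have k3 := htg1
    have k4 := htg2
    have o1 := hg1
    have o3 := hg3
    unfold relRittLowerType at k1 k2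
    unfold relRittWeakType at k3 k4
    rw [erg, EReal.toReal_coe] at k1 k2
    rw [elg, EReal.toReal_coe] at k3 k4
    rcases m with _ | m <;> rcases p with _ | p
    · have e1 : rg = 1 := case_L3 (B := fun σ => σ) (C := ψ) tendsto_id o1 o3 k1 k2
      have e2 : lg = 1 := case_L3 (B := fun σ => σ) (C := ψ) tendsto_id o1 o3 k3 k4
      rw [elg, erg, e1, e2]
    · exfalso
      unfold relRittOrder at o3
      simp only [Function.iterate_succ_apply'] at o3
      exact case_L1 (B := fun σ => Real.log^[p] σ) (C := ψ) hrg (tendsto_log_iter p tendsto_id) o3 k1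
    · exfalso
      unfold relRittLowerOrder at o1
      simp only [Function.iterate_succ_apply'] at o1
      exact case_L2 (B := fun σ => σ) (C := fun σ => Real.log^[m] (ψ σ)) tendsto_id
        (tendsto_log_iter m hψt) o1 k2
    · refine le_antisymm hg2 ?_
      have := case_L0 (B := fun σ => Real.log^[p] σ) (C := fun σ => Real.log^[m] (ψ σ))
        (tendsto_log_iter p tendsto_id) k1
      rw [erg]
      unfold relRittLowerOrder
      simp only [Function.iterate_succ_apply']
      exact this
  have hty : relRittWeakType m p g h = relRittLowerType m p g h := by
    unfold relRittWeakType relRittLowerType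
    rw [hreg]
  rw [hty, hreg, min_self, eT, eD, erg, EReal.toReal_coe, EReal.toReal_coe, EReal.toReal_coe]
  have hρ : lf / rg ≤ (relRittOrder p q f g).toReal := by
    obtain ⟨K, -, hK⟩ := ereal_lt_real hf3
    have hK' := ev_of_limsup_lt hK
    have hc : ((lg / 2 : ℝ) : EReal) < relRittLowerOrder m p g h := by
      rw [elg]; exact_mod_cast half_lt_self hlg
    have hc' := hXt.eventually (ev_of_lt_liminf hc)
    refine order_ge (U := fun σ => Real.log^[m] (φ σ)) (V := fun σ => Real.log^[q] σ)
      (W := fun σ => Real.log^[p] (X σ)) (K := K) (c := lg / 2) hlf hrg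
      (tendsto_log_iter q tendsto_id) (tendsto_log_iter p hXt) elf.symm.le ?_ (by linarith) hK' ?_
    · intro b hb
      have hb' : relRittOrder m p g h < (b : EReal) := by rw [erg]; exact_mod_cast hb
      filter_upwards [hXt.eventually (ev_of_limsup_lt hb'), hcomp] with σ h1 h2
      rw [← h2]; exact h1
    · filter_upwards [hc', hcomp] with σ h1 h2
      rw [← h2]; exact h1
  refine type_le (A := fun σ => Real.log^[q-1] σ) (B := fun σ => Real.log^[p-1] (X σ))
    (C := fun σ => Real.log^[m-1] (φ σ)) (l := lf) hrg hD hT (tendsto_log_iter _ tendsto_id)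
    (tendsto_log_iter _ hXt) ?_ ?_ hρ
  · intro c hc
    have hc' : relRittUpperWeakType m q f h < (c : EReal) := by rw [eT]; exact_mod_cast hc
    unfold relRittUpperWeakType at hc'
    rw [elf, EReal.toReal_coe] at hc'
    exact ev_of_limsup_lt hc'
  · intro c hc
    have hc' : (c : EReal) < relRittLowerType m p g h := by rw [eD]; exact_mod_cast hc
    unfold relRittLowerType at hc'
    rw [erg, EReal.toReal_coe] at hc'
    filter_upwards [hXt.eventually (ev_of_lt_liminf hc'), hcomp] with σ h1 h2
    rw [← h2]; exact h1
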